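/- arXiv:1607.08902 — 2 statements merged into one kernel-verified Lean document; each statement's English description precedes it below -/
import Mathlib

section
/- Let ν, κ ∈ ℝ with κ² − ν² ≥ 1/4. Consider the densely defined symmetric operator D^{ν,κ} in the Hilbert space L²((0,∞), ℂ²) whose domain is the space of smooth compactly supported functions C_c^∞((0,∞), ℂ²) and which acts by (D^{ν,κ}f)(r) = ( −(ν/r)f₁(r) − f₂′(r) − (κ/r)f₂(r) , f₁′(r) − (κ/r)f₁(r) − (ν/r)f₂(r) ). Then D^{ν,κ} is essentially self-adjoint, i.e. its closure is a self-adjoint operator in L²((0,∞), ℂ²). -/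
open MeasureTheory Set Complex

noncomputable section

/-- `ℂ²` with its Euclidean (Hilbert space) structure. -/
abbrev CD2 : Type := EuclideanSpace ℂ (Fin 2)

/-- Build an element of `ℂ²` from its two components. -/
def mk2 (a b : ℂ) : CD2 := (WithLp.equiv 2 (Fin 2 → ℂ)).symm ![a, b]

/-- Lebesgue measure restricted to the half-line `(0, ∞)`. -/
def halfLineMeasure : Measure ℝ := volume.restrict (Ioi 0)

/-- The Coulomb–Dirac differential expression `d^{ν,κ}` applied to a function
`g = (g₁, g₂) : ℝ → ℂ²`:
`(d^{ν,κ}g)(r) = ( −(ν/r)g₁(r) − g₂′(r) − (κ/r)g₂(r) , g₁′(r) − (κ/r)g₁(r) − (ν/r)g₂(r) )`. -/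
def diracAct (ν κ : ℝ) (g : ℝ → CD2) : ℝ → CD2 := fun r =>
  mk2
    (-((ν : ℂ) / (r : ℂ)) * g r 0 - deriv (fun s => g s 1) r - ((κ : ℂ) / (r : ℂ)) * g r 1)
    (deriv (fun s => g s 0) r - ((κ : ℂ) / (r : ℂ)) * g r 0 - ((ν : ℂ) / (r : ℂ)) * g r 1)

/-- A test function on the open half-line: smooth, compactly supported, with support
contained in `(0, ∞)`. -/
def IsHalfLineTestFun (g : ℝ → CD2) : Prop :=
  ContDiff ℝ (⊤ : ℕ∞) g ∧ HasCompactSupport g ∧ tsupport g ⊆ Ioi 0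


open LinearPMap in
lemma abs_sa {H : Type*} [NormedAddCommGroup H] [InnerProductSpace ℂ H] [CompleteSpace H]
    (T : H →ₗ.[ℂ] H) (hd : Dense (T.domain : Set H)) (hs : T.IsFormalAdjoint T)
    (hk : ∀ σ : ℝ, (σ = 1 ∨ σ = -1) → ∀ u : H,
      (∀ x : T.domain, inner ℂ (T x) u = (σ * I) * inner ℂ (x : H) u) → u = 0) :
    IsSelfAdjoint T.closure := by
  have hcl : T.IsClosable :=
    isClosable_iff_exists_closed_extension.2 ⟨_, adjoint_isClosed hd, hs.le_adjoint hd⟩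
  have hd' : Dense (T.closure.domain : Set H) := hd.mono (T.le_closure.1)
  rw [isSelfAdjoint_def]
  apply eq_of_eq_graph
  rw [LinearPMap.adjoint_graph_eq_graph_adjoint hd']
  have hcg := hcl.graph_closure_eq_closure_graph
  have hTA : T.graph ≤ T.closure.graph := by rw [← hcg]; exact T.graph.le_topologicalClosure
  -- closure is contained in the adjoint
  have hle : T.closure.graph ≤ T.graph.adjoint := by
    rw [← LinearPMap.adjoint_graph_eq_graph_adjoint hd]
    rw [← hcg]
    apply Submodule.topologicalClosure_minimal _ _ (adjoint_isClosed hd)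
    exact le_graph_of_le (hs.le_adjoint hd)
  have hanti : T.closure.graph.adjoint ≤ T.graph.adjoint := by
    intro z hz
    rw [Submodule.mem_adjoint_iff] at hz ⊢
    intro a b hab
    exact hz a b (hTA hab)
  apply le_antisymm
  · intro z hz
    have hz' := hanti hz
    let K : Submodule ℂ (WithLp 2 (H × H)) :=
      T.closure.graph.comap (WithLp.linearEquiv 2 ℂ (H × H)).toLinearMap
    have hKc : IsClosed (K : Set (WithLp 2 (H × H))) := by
      have : IsClosed (T.closure.graph : Set (H × H)) := hcl.closure_isClosed
      exact this.preimage (WithLp.prod_continuous_ofLp 2 H H)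
    have : CompleteSpace K := hKc.completeSpace_coe
    obtain ⟨k, hk1, e, he, hke⟩ := K.exists_add_mem_mem_orthogonal (WithLp.toLp 2 z)
    have hkz : (WithLp.ofLp k) ∈ T.closure.graph := hk1
    have hea : WithLp.ofLp e ∈ T.graph.adjoint := by
      have : WithLp.ofLp e = z - WithLp.ofLp k := by
        have := congrArg WithLp.ofLp hke
        simp at this
        rw [this]; simp
      rw [this]
      exact Submodule.sub_mem _ hz' (hle hkz)
    obtain ⟨p, q⟩ := e
    rw [Submodule.mem_adjoint_iff] at hea
    have A1 : ∀ x : T.domain, inner ℂ (T x) p = inner ℂ (x : H) q := fun x =>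
      sub_eq_zero.1 (hea x (T x) (T.mem_graph x))
    have A2 : ∀ x : T.domain, inner ℂ (T x) q = - inner ℂ (x : H) p := by
      intro x
      have := (Submodule.mem_orthogonal _ _).1 he (WithLp.toLp 2 ((x : H), T x)) (hTA (T.mem_graph x))
      simp at this
      linear_combination this
    have B1 := hk 1 (Or.inl rfl) (q + I • p) (by
      intro x
      simp only [inner_add_right, inner_smul_right, A1, A2]
      push_cast
      linear_combination (-inner ℂ (x : H) p) * I_mul_I)
    have B2 := hk (-1) (Or.inr rfl) (q - I • p) (by
      intro x
      simp only [inner_sub_right, inner_smul_right, A1, A2]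
      push_cast
      linear_combination (-inner ℂ (x : H) p) * I_mul_I)
    have hq : q = 0 := by
      have h3 : (2:ℂ) • q = 0 := by
        rw [two_smul]
        calc q + q = (q + I • p) + (q - I • p) := by abel
          _ = 0 := by rw [B1, B2, add_zero]
      simpa using h3
    have hp : p = 0 := by
      rw [hq] at B1
      simpa using B1
    have : z = WithLp.ofLp k := by
      have := congrArg WithLp.ofLp hke
      subst hq hp
      simp only [WithLp.ofLp_add] at this
      exact this.trans (add_zero _)
    rw [this]; exact hkz
  · intro z hz
    rw [Submodule.mem_adjoint_iff]
    intro a b hab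
    have h1 := hle hz
    rw [Submodule.mem_adjoint_iff] at h1
    have hc : IsClosed {w : H × H | inner ℂ w.2 z.1 - inner ℂ w.1 z.2 = 0} :=
      isClosed_eq (by fun_prop) continuous_const
    have h2 : closure (T.graph : Set (H × H)) ⊆
        {w : H × H | inner ℂ w.2 z.1 - inner ℂ w.1 z.2 = 0} :=
      closure_minimal (fun w hw => h1 w.1 w.2 hw) hc
    rw [← hcg] at hab
    exact h2 hab

lemma not_int_inv {f : ℝ → ℝ} (hf : IntegrableOn f (Ioi 0)) {δ r0 : ℝ} (hδ : 0 < δ) (hr : 0 < r0)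
    (hb : ∀ r, 0 < r → r < r0 → δ / r ≤ f r) : False := by
  have h1 : IntegrableOn f (Ioo 0 r0) := hf.mono_set (fun x hx => hx.1)
  have h2 : IntegrableOn (fun r : ℝ => δ / r) (Ioo 0 r0) := by
    refine Integrable.mono' h1 (by fun_prop) ?_
    refine (ae_restrict_iff' measurableSet_Ioo).2 (Filter.Eventually.of_forall fun r hx => ?_)
    rw [Real.norm_of_nonneg (div_nonneg hδ.le hx.1.le)]
    exact hb r hx.1 hx.2
  have h3 : IntegrableOn (fun r : ℝ => r⁻¹) (Ioo 0 r0) := by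
    have := Integrable.const_mul h2 δ⁻¹
    refine Integrable.congr this (Filter.Eventually.of_forall fun r => ?_)
    simp only
    field_simp
  have h4 : IntervalIntegrable (fun r : ℝ => r⁻¹) volume 0 r0 := by
    rw [intervalIntegrable_iff_integrableOn_Ioo_of_le hr.le]
    exact h3
  rw [intervalIntegrable_inv_iff] at h4
  rcases h4 with h4 | h4
  · exact hr.ne h4
  · exact h4 left_mem_uIcc

/-- decay bound of the singular component -/
lemma decay_bound {s : ℝ} (hs : 1 / 2 ≤ s) {lam : ℂ} (hl : ‖lam‖ = 1) {a b : ℝ → ℂ}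
    (ha : ∀ r, 0 < r → HasDerivAt a (-((s : ℂ) / r) * a r + lam * b r) r)
    (hbc : ContinuousOn b (Ioi 0))
    (hia : IntegrableOn (fun r => ‖a r‖ ^ 2) (Ioi 0))
    (hib : IntegrableOn (fun r => ‖b r‖ ^ 2) (Ioi 0)) :
    ∃ C : ℝ, 0 < C ∧ ∀ r, 0 < r → ‖a r‖ ^ 2 ≤ C * r := by
  set B := ∫ r in Ioi 0, ‖b r‖ ^ 2 with hB
  have hB0 : 0 ≤ B := integral_nonneg fun r => by positivity
  have hs0 : 0 < s := by linarith
  set h : ℝ → ℂ := fun r => ((r ^ s : ℝ) : ℂ) * a r with hh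
  have hder : ∀ r, 0 < r → HasDerivAt h (((r ^ s : ℝ) : ℂ) * (lam * b r)) r := by
    intro r hr
    have h1 : HasDerivAt (fun r : ℝ => r ^ s) (s * r ^ (s - 1)) r :=
      Real.hasDerivAt_rpow_const (Or.inl hr.ne')
    have h2 := h1.ofReal_comp.mul (ha r hr)
    refine HasDerivAt.congr_deriv h2 ?_
    rw [Real.rpow_sub_one hr.ne']
    have : (r : ℂ) ≠ 0 := by exact_mod_cast hr.ne'
    push_cast
    field_simp
    ring
  have hdiff : ∀ r e, 0 < e → e < r → ‖h r - h e‖ ≤ r ^ s * (√r * (1 + B) / 2) := by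
    intro r e he her
    have hr : 0 < r := he.trans her
    have hsub : Icc e r ⊆ Ioi 0 := fun x hx => he.trans_le hx.1
    have hcont : ContinuousOn (fun r : ℝ => ((r ^ s : ℝ) : ℂ) * (lam * b r)) (Icc e r) := by
      have : ContinuousOn (fun r : ℝ => ((r ^ s : ℝ) : ℂ)) (Icc e r) :=
        (Complex.continuous_ofReal.comp (Real.continuous_rpow_const hs0.le)).continuousOn
      exact this.mul (continuousOn_const.mul (hbc.mono hsub))
    rw [← intervalIntegral.integral_eq_sub_of_hasDerivAt (f := h)
      (f' := fun r => ((r ^ s : ℝ) : ℂ) * (lam * b r))]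
    · have hgi : IntervalIntegrable (fun t => r ^ s * ((√r)⁻¹ / 2 + √r / 2 * ‖b t‖ ^ 2)) volume e r := by
        apply ContinuousOn.intervalIntegrable
        rw [uIcc_of_le her.le]
        have := hbc.mono hsub
        fun_prop
      refine (intervalIntegral.norm_integral_le_of_norm_le her.le
        (g := fun t => r ^ s * ((√r)⁻¹ / 2 + √r / 2 * ‖b t‖ ^ 2)) ?_ hgi).trans ?_
      · refine Filter.Eventually.of_forall fun t ht => ?_
        have ht0 : 0 < t := he.trans ht.1
        rw [norm_mul, norm_mul, hl, one_mul, Complex.norm_real, Real.norm_of_nonneg (by positivity)]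
        have h1 : t ^ s ≤ r ^ s := Real.rpow_le_rpow ht0.le ht.2 hs0.le
        have h2 : ‖b t‖ ≤ (√r)⁻¹ / 2 + √r / 2 * ‖b t‖ ^ 2 := by
          have hq : 0 < √r := Real.sqrt_pos.2 hr
          have : (√r)⁻¹ / 2 + √r / 2 * ‖b t‖ ^ 2 - ‖b t‖ = (√r * ‖b t‖ - 1) ^ 2 / (2 * √r) := by
            field_simp; ring
          have h4 : 0 ≤ (√r * ‖b t‖ - 1) ^ 2 / (2 * √r) := by positivity
          linarith
        exact mul_le_mul h1 h2 (norm_nonneg _) (by positivity)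
      · rw [intervalIntegral.integral_const_mul]
        apply mul_le_mul_of_nonneg_left _ (by positivity)
        have hi2 : IntervalIntegrable (fun t => ‖b t‖ ^ 2) volume e r := by
          rw [intervalIntegrable_iff_integrableOn_Ioc_of_le her.le]
          exact hib.mono_set fun x hx => he.trans hx.1
        rw [intervalIntegral.integral_add (by simp) (hi2.const_mul _),
          intervalIntegral.integral_const_mul, intervalIntegral.integral_const]
        have h5 : ∫ t in e..r, ‖b t‖ ^ 2 ≤ B := by
          rw [intervalIntegral.integral_of_le her.le]
          apply setIntegral_mono_set hib
          · exact Filter.Eventually.of_forall fun t => by positivity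
          · exact Filter.Eventually.of_forall fun x (hx : x ∈ Ioc e r) => he.trans hx.1
        have hq : 0 < √r := Real.sqrt_pos.2 hr
        have h6 : (r - e) * ((√r)⁻¹ / 2) ≤ √r / 2 := by
          have : r * ((√r)⁻¹ / 2) = √r / 2 := by
            have := Real.mul_self_sqrt hr.le
            field_simp
            linarith
          have h7 : 0 ≤ e * ((√r)⁻¹ / 2) := by positivity
          linarith
        have h8 : √r / 2 * ∫ t in e..r, ‖b t‖ ^ 2 ≤ √r / 2 * B :=
          mul_le_mul_of_nonneg_left h5 (by positivity)
        simp only [smul_eq_mul]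
        linarith
    · intro x hx
      rw [uIcc_of_le her.le] at hx
      exact hder x (hsub hx)
    · apply ContinuousOn.intervalIntegrable
      rw [uIcc_of_le her.le]
      exact hcont
  have hbd : ∀ r, 0 < r → ‖h r‖ ≤ r ^ s * (√r * (1 + B) / 2) := by
    intro r hr
    by_contra hcon
    push Not at hcon
    set δ := ‖h r‖ - r ^ s * (√r * (1 + B) / 2) with hδ
    have hδ0 : 0 < δ := by linarith
    refine not_int_inv hia (δ := δ ^ 2) (r0 := min r 1) (by positivity) (by positivity) ?_
    intro e he her
    have her1 : e < r := her.trans_le (min_le_left _ _)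
    have he1 : e < 1 := her.trans_le (min_le_right _ _)
    have h1 := hdiff r e he her1
    have h2 : ‖h r‖ ≤ ‖h r - h e‖ + ‖h e‖ := by
      simpa using norm_add_le (h r - h e) (h e)
    have h3 : δ ≤ ‖h e‖ := by linarith
    have h4 : ‖h e‖ = e ^ s * ‖a e‖ := by
      simp only [hh]
      rw [norm_mul, Complex.norm_real, Real.norm_of_nonneg (by positivity)]
    have h5 : e ^ s ≤ √e := by
      rw [Real.sqrt_eq_rpow]
      exact Real.rpow_le_rpow_of_exponent_ge he he1.le hs
    have h6 : δ ≤ √e * ‖a e‖ := by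
      rw [h4] at h3
      exact h3.trans (mul_le_mul_of_nonneg_right h5 (norm_nonneg _))
    rw [div_le_iff₀ he]
    calc δ ^ 2 ≤ (√e * ‖a e‖) ^ 2 := by gcongr
      _ = ‖a e‖ ^ 2 * e := by rw [mul_pow, Real.sq_sqrt he.le]; ring
  refine ⟨((1 + B) / 2) ^ 2, by positivity, fun r hr => ?_⟩
  have h1 := hbd r hr
  have h4 : ‖h r‖ = r ^ s * ‖a r‖ := by
    simp only [hh]
    rw [norm_mul, Complex.norm_real, Real.norm_of_nonneg (by positivity)]
  rw [h4] at h1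
  have h2 := le_of_mul_le_mul_left h1 (by positivity)
  calc ‖a r‖ ^ 2 ≤ (√r * (1 + B) / 2) ^ 2 := by gcongr
    _ = (√r) ^ 2 * ((1 + B) / 2) ^ 2 := by ring
    _ = _ := by rw [Real.sq_sqrt hr.le]; ring

lemma exists_eig {ν κ : ℝ} (h : 1 / 4 ≤ κ ^ 2 - ν ^ 2) : ∃ s x y : ℝ, 1 / 2 ≤ s ∧
    0 < x ^ 2 + y ^ 2 ∧ x * κ - y * ν = - s * x ∧ x * ν - y * κ = - s * y := by
  have h1 : Real.sqrt (κ ^ 2 - ν ^ 2) ^ 2 = κ ^ 2 - ν ^ 2 := Real.sq_sqrt (by linarith)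
  have h2 : 1 / 2 ≤ Real.sqrt (κ ^ 2 - ν ^ 2) := by
    apply Real.le_sqrt_of_sq_le; norm_num; linarith
  set s := Real.sqrt (κ ^ 2 - ν ^ 2)
  rcases le_total 0 κ with hκ | hκ
  · refine ⟨s, ν, κ + s, h2, ?_, by ring, by linarith⟩
    have : 0 < (κ + s) ^ 2 := by positivity
    positivity
  · refine ⟨s, κ - s, ν, h2, ?_, by linarith, by ring⟩
    have : 0 < (κ - s) ^ 2 := by
      apply sq_pos_of_neg; linarith
    positivity

lemma ode_zero {ν κ σ : ℝ} (h : 1 / 4 ≤ κ ^ 2 - ν ^ 2) (hσ : σ = 1 ∨ σ = -1) {v0 v1 : ℝ → ℂ}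
    (h0 : ∀ r : ℝ, 0 < r → HasDerivAt v0
      ((κ / r : ℂ) * v0 r + (ν / r : ℂ) * v1 r + (σ * I) * v1 r) r)
    (h1 : ∀ r : ℝ, 0 < r → HasDerivAt v1
      (-((κ / r : ℂ) * v1 r + (ν / r : ℂ) * v0 r + (σ * I) * v0 r)) r)
    (hi0 : IntegrableOn (fun r => ‖v0 r‖ ^ 2) (Ioi 0))
    (hi1 : IntegrableOn (fun r => ‖v1 r‖ ^ 2) (Ioi 0)) :
    ∀ r, 0 < r → v0 r = 0 ∧ v1 r = 0 := by
  obtain ⟨s, x, y, hs, hxy, e1, e2⟩ := exists_eig h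
  have hσ2 : σ ^ 2 = 1 := by rcases hσ with rfl | rfl <;> norm_num
  have c0 : ContinuousOn v0 (Ioi 0) := fun r hr => (h0 r hr).continuousAt.continuousWithinAt
  have c1 : ContinuousOn v1 (Ioi 0) := fun r hr => (h1 r hr).continuousAt.continuousWithinAt
  set N : ℝ → ℝ := fun r => ‖v0 r‖ ^ 2 + ‖v1 r‖ ^ 2 with hN
  have hNi : IntegrableOn N (Ioi 0) := hi0.add hi1
  have hcomb : ∀ p q : ℝ, IntegrableOn (fun r => ‖(p : ℂ) * v0 r + (q : ℂ) * v1 r‖ ^ 2) (Ioi 0) := by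
    intro p q
    refine Integrable.mono' (hNi.const_mul (p ^ 2 + q ^ 2)) ?_ ?_
    · apply ContinuousOn.aestronglyMeasurable _ measurableSet_Ioi
      fun_prop
    · refine Filter.Eventually.of_forall fun r => ?_
      rw [Real.norm_of_nonneg (by positivity)]
      have : ‖(p : ℂ) * v0 r + (q : ℂ) * v1 r‖ ≤ |p| * ‖v0 r‖ + |q| * ‖v1 r‖ := by
        refine (norm_add_le _ _).trans (le_of_eq ?_)
        simp
      have h2 : ‖(p : ℂ) * v0 r + (q : ℂ) * v1 r‖ ^ 2 ≤ (|p| * ‖v0 r‖ + |q| * ‖v1 r‖) ^ 2 := by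
        gcongr
      simp only [hN]
      have hp := sq_abs p
      have hq := sq_abs q
      nlinarith [sq_nonneg (|p| * ‖v1 r‖ - |q| * ‖v0 r‖)]
  set W : ℝ → ℝ := fun r => σ * ((v0 r).re * (v1 r).im - (v0 r).im * (v1 r).re) with hW
  have hNre : ∀ r, N r = (v0 r).re ^ 2 + (v0 r).im ^ 2 + (v1 r).re ^ 2 + (v1 r).im ^ 2 := by
    intro r
    simp only [hN, Complex.sq_norm, Complex.normSq_apply]
    ring
  have hWd : ∀ r, 0 < r → HasDerivAt W (- N r) r := by
    intro r hr
    have a0 := h0 r hr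
    have a1 := h1 r hr
    have r0 := Complex.reCLM.hasFDerivAt.comp_hasDerivAt r a0
    have i0 := Complex.imCLM.hasFDerivAt.comp_hasDerivAt r a0
    have r1 := Complex.reCLM.hasFDerivAt.comp_hasDerivAt r a1
    have i1 := Complex.imCLM.hasFDerivAt.comp_hasDerivAt r a1
    have := ((r0.mul i1).sub (i0.mul r1)).const_mul σ
    refine HasDerivAt.congr_deriv this ?_
    rw [hNre]
    have hk : ((κ : ℂ) / r) = ((κ / r : ℝ) : ℂ) := by push_cast; rfl
    have hn : ((ν : ℂ) / r) = ((ν / r : ℝ) : ℂ) := by push_cast; rfl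
    rw [hk, hn]
    simp only [Complex.reCLM_apply, Complex.imCLM_apply, Function.comp, Complex.add_re, Complex.neg_re,
      Complex.neg_im, Complex.add_im, Complex.mul_re, Complex.mul_im, Complex.ofReal_re,
      Complex.ofReal_im, Complex.I_re, Complex.I_im]
    linear_combination (-((v0 r).re ^ 2 + (v0 r).im ^ 2 + (v1 r).re ^ 2 + (v1 r).im ^ 2)) * hσ2
  have hanti : AntitoneOn W (Ioi 0) := by
    apply antitoneOn_of_deriv_nonpos (convex_Ioi 0)
    · exact fun r hr => (hWd r hr).continuousAt.continuousWithinAt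
    · intro r hr
      rw [interior_Ioi] at hr
      exact (hWd r hr).differentiableAt.differentiableWithinAt
    · intro r hr
      rw [interior_Ioi] at hr
      rw [(hWd r hr).deriv]
      have : 0 ≤ N r := by positivity
      linarith
  have hσabs : |σ| = 1 := by rcases hσ with rfl | rfl <;> norm_num
  -- W ≥ 0
  have hW1 : ∀ r, 0 < r → 0 ≤ W r := by
    intro r hr
    by_contra hc
    push Not at hc
    have hi : IntegrableOn (fun _ : ℝ => W r) (Ioi r) := by
      refine Integrable.mono' (hNi.mono_set (Ioi_subset_Ioi hr.le)) (by fun_prop) ?_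
      refine (ae_restrict_iff' measurableSet_Ioi).2 (Filter.Eventually.of_forall fun t ht => ?_)
      have h2 := hanti hr (hr.trans ht) (le_of_lt ht)
      rw [Real.norm_of_nonpos hc.le]
      have h3 : - W t ≤ N t := by
        rw [hNre]
        simp only [hW]
        rcases hσ with rfl | rfl
        · nlinarith [sq_nonneg ((v0 t).re + (v1 t).im), sq_nonneg ((v0 t).im - (v1 t).re),
            sq_nonneg ((v0 t).re), sq_nonneg ((v0 t).im), sq_nonneg ((v1 t).re),
            sq_nonneg ((v1 t).im)]
        · nlinarith [sq_nonneg ((v0 t).re - (v1 t).im), sq_nonneg ((v0 t).im + (v1 t).re),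
            sq_nonneg ((v0 t).re), sq_nonneg ((v0 t).im), sq_nonneg ((v1 t).re),
            sq_nonneg ((v1 t).im)]
      linarith
    rw [integrableOn_const_iff] at hi
    rcases hi with hi | hi
    · exact hc.ne (by simpa using hi)
    · simp at hi
  -- W ≤ 0
  have hW2 : ∀ r, 0 < r → W r ≤ 0 := by
    intro r hr
    by_contra hc
    push Not at hc
    set a : ℝ → ℂ := fun r => (x : ℂ) * v0 r + (y : ℂ) * v1 r with ha
    set b : ℝ → ℂ := fun r => ((-y : ℝ) : ℂ) * v0 r + (x : ℂ) * v1 r with hb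
    obtain ⟨C, hC, hCb⟩ := decay_bound (s := s) (lam := σ * I) (a := a) (b := b) hs
      (by simp [hσabs]) (by
        intro t ht
        have := ((h0 t ht).const_mul (x : ℂ)).add ((h1 t ht).const_mul (y : ℂ))
        refine HasDerivAt.congr_deriv this ?_
        have e1' : (x : ℂ) * κ - y * ν = - s * x := by exact_mod_cast e1
        have e2' : (x : ℂ) * ν - y * κ = - s * y := by exact_mod_cast e2
        simp only [ha, hb]
        push_cast
        linear_combination (v0 t / t) * e1' + (v1 t / t) * e2') (by fun_prop) (hcomb x y)
        (hcomb (-y) x)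
    refine not_int_inv (hcomb (-y) x) (δ := ((x ^ 2 + y ^ 2) * W r) ^ 2 / C) (r0 := r) (by positivity)
      hr ?_
    intro t ht htr
    have h2 := hanti ht hr htr.le
    have h3 : (x ^ 2 + y ^ 2) * W t ≤ ‖a t‖ * ‖b t‖ := by
      have : (x ^ 2 + y ^ 2) * W t = σ * ((starRingEnd ℂ (a t)) * b t).im := by
        simp only [hW, ha, hb, Complex.mul_im, Complex.conj_re, Complex.conj_im, Complex.add_re,
          Complex.add_im, Complex.mul_re, Complex.ofReal_re, Complex.ofReal_im]
        ring
      rw [this]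
      calc σ * ((starRingEnd ℂ (a t)) * b t).im ≤ |σ * ((starRingEnd ℂ (a t)) * b t).im| := le_abs_self _
        _ = |((starRingEnd ℂ (a t)) * b t).im| := by rw [abs_mul, hσabs, one_mul]
        _ ≤ ‖(starRingEnd ℂ (a t)) * b t‖ := Complex.abs_im_le_norm _
        _ = _ := by simp
    have h4 : (x ^ 2 + y ^ 2) * W r ≤ ‖a t‖ * ‖b t‖ :=
      (mul_le_mul_of_nonneg_left h2 hxy.le).trans h3
    have h5 : ((x ^ 2 + y ^ 2) * W r) ^ 2 ≤ ‖a t‖ ^ 2 * ‖b t‖ ^ 2 := by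
      rw [← mul_pow]
      have : 0 ≤ (x ^ 2 + y ^ 2) * W r := by positivity
      gcongr
    have h6 := mul_le_mul_of_nonneg_right (hCb t ht) (sq_nonneg ‖b t‖)
    rw [div_div, div_le_iff₀ (by positivity)]
    linarith
  intro r hr
  have hN0 : N r = 0 := by
    have h2 : W =ᶠ[nhds r] fun _ => 0 := by
      filter_upwards [Ioi_mem_nhds hr] with t ht
      exact le_antisymm (hW2 t ht) (hW1 t ht)
    have h3 := (hWd r hr).congr_of_eventuallyEq h2.symm
    have := h3.unique (hasDerivAt_const r (0:ℝ))
    linarith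
  simp only [hN] at hN0
  have h2 := sq_nonneg ‖v0 r‖
  have h3 := sq_nonneg ‖v1 r‖
  constructor
  · have : ‖v0 r‖ ^ 2 = 0 := by linarith
    simpa using this
  · have : ‖v1 r‖ ^ 2 = 0 := by linarith
    simpa using this

structure RTest (φ : ℝ → ℝ) : Prop where
  smooth : ContDiff ℝ (⊤ : ℕ∞) φ
  supp : HasCompactSupport φ
  sub : tsupport φ ⊆ Ioi 0

lemma RTest.bounds {φ : ℝ → ℝ} (h : RTest φ) : ∃ a b : ℝ, 0 < a ∧ a < 1 ∧ 1 < b ∧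
    tsupport φ ⊆ Ioo a b := by
  have hK : IsCompact (insert 1 (tsupport φ)) := IsCompact.insert h.supp 1
  obtain ⟨m, hm, hm'⟩ := hK.exists_isLeast (insert_nonempty _ _)
  obtain ⟨M, hM, hM'⟩ := hK.exists_isGreatest (insert_nonempty _ _)
  have hm0 : 0 < m := by
    rcases hm with rfl | hm
    · norm_num
    · exact h.sub hm
  have m1 : m ≤ 1 := hm' (mem_insert _ _)
  have M1 : 1 ≤ M := hM' (mem_insert _ _)
  refine ⟨m / 2, M + 1, by linarith, by linarith, by linarith, fun x hx => ?_⟩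
  have h1 := hm' (mem_insert_of_mem _ hx)
  have h2 := hM' (mem_insert_of_mem _ hx)
  constructor <;> linarith

lemma RTest.deriv_zero {φ : ℝ → ℝ} {r : ℝ} (hr : r ∉ tsupport φ) : deriv φ r = 0 := by
  by_contra h
  exact hr (support_deriv_subset h)

lemma setInt_eq {E : Type*} [NormedAddCommGroup E] [NormedSpace ℝ E] {f : ℝ → E} {a b : ℝ} (ha : 0 < a) (hab : a < b)
    (hf : ∀ r, r ∉ Ioo a b → f r = 0) : ∫ r in Ioi 0, f r = ∫ r in a..b, f r := by
  rw [intervalIntegral.integral_of_le hab.le, setIntegral_eq_integral_of_forall_compl_eq_zero,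
    setIntegral_eq_integral_of_forall_compl_eq_zero]
  · exact fun x hx => hf x fun h => hx ⟨h.1, h.2.le⟩
  · exact fun x hx => hf x fun h => hx (ha.trans h.1)

lemma loc_ii {F : ℝ → ℝ} (hF : LocallyIntegrableOn F (Ioi 0)) {a b : ℝ} (ha : 0 < a) (hb : 0 < b) :
    IntervalIntegrable F volume a b := by
  rw [intervalIntegrable_iff']
  apply hF.integrableOn_compact_subset _ isCompact_uIcc
  intro x hx
  exact (lt_min ha hb).trans_le hx.1

lemma prim_cont {F : ℝ → ℝ} (hF : LocallyIntegrableOn F (Ioi 0)) :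
    ContinuousOn (fun r => ∫ t in (1:ℝ)..r, F t) (Ioi 0) := by
  intro r hr
  have hr0 : (0:ℝ) < r := hr
  have ha : 0 < min r 1 / 2 := by positivity
  have hb : 0 < max r 1 + 1 := by positivity
  have h := (loc_ii hF ha hb).absolutelyContinuousOnInterval_intervalIntegral (c := 1) (by
    rw [uIcc_of_le]
    · constructor
      · have := min_le_right r 1; linarith
      · have := le_max_right r 1; linarith
    · have := min_le_right r 1; have := le_max_right r 1; linarith)
  apply ContinuousAt.continuousWithinAt
  apply h.continuousOn.continuousAt
  rw [uIcc_of_le]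
  · apply Icc_mem_nhds
    · have := min_le_left r 1; linarith
    · have := le_max_left r 1; linarith
  · have := min_le_right r 1; have := le_max_right r 1; linarith

lemma prim_parts {F : ℝ → ℝ} (hF : LocallyIntegrableOn F (Ioi 0)) {φ : ℝ → ℝ} (hφ : RTest φ) :
    ∫ r in Ioi 0, deriv φ r * (∫ t in (1:ℝ)..r, F t) = - ∫ r in Ioi 0, φ r * F r := by
  obtain ⟨a, b, ha, ha1, hb1, hs⟩ := hφ.bounds
  have hz : ∀ r, r ∉ Ioo a b → φ r = 0 := fun r hr => image_eq_zero_of_notMem_tsupport fun h => hr (hs h)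
  have hz' : ∀ r, r ∉ Ioo a b → deriv φ r = 0 := fun r hr => RTest.deriv_zero fun h => hr (hs h)
  have hab : a < b := ha1.trans hb1
  have hb : 0 < b := by linarith
  rw [setInt_eq ha hab (fun r hr => by simp [hz' r hr]), setInt_eq ha hab (fun r hr => by simp [hz r hr])]
  have hii := loc_ii hF ha hb
  have h1 := hii.absolutelyContinuousOnInterval_intervalIntegral (c := 1) (by
    rw [uIcc_of_le hab.le]; exact ⟨ha1.le, hb1.le⟩)
  have h2 : AbsolutelyContinuousOnInterval φ a b :=
    ContDiffOn.absolutelyContinuousOnInterval (hφ.smooth.of_le (by simp)).contDiffOn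
  have h3 := h1.integral_mul_deriv_eq_deriv_mul h2
  have h4 : ∀ᵐ x, x ∈ uIoc a b → deriv (fun r => ∫ t in (1:ℝ)..r, F t) x * φ x = φ x * F x := by
    have := hii.ae_hasDerivAt_integral
    filter_upwards [this] with x hx hxab
    rw [(hx (uIoc_subset_uIcc hxab) 1 (by rw [uIcc_of_le hab.le]; exact ⟨ha1.le, hb1.le⟩)).deriv, mul_comm]
  rw [intervalIntegral.integral_congr_ae h4] at h3
  rw [hz a (by simp), hz b (by simp)] at h3
  simp only [mul_zero, sub_zero, zero_sub] at h3
  rw [← h3]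
  congr 1; ext r; ring

lemma weak_const {h : ℝ → ℝ} (hh : LocallyIntegrableOn h (Ioi 0))
    (hw : ∀ φ, RTest φ → ∫ r in Ioi 0, deriv φ r * h r = 0) :
    ∃ c, ∀ᵐ r, r ∈ Ioi (0:ℝ) → h r = c := by
  let bump : ContDiffBump (1:ℝ) := ⟨1/4, 1/2, by norm_num, by norm_num⟩
  set ψ : ℝ → ℝ := bump.normed volume with hψdef
  have hψ : RTest ψ := by
    refine ⟨bump.contDiff_normed, bump.hasCompactSupport_normed, ?_⟩
    rw [hψdef, bump.tsupport_normed_eq]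
    intro x hx
    rw [Real.closedBall_eq_Icc] at hx
    have := hx.1
    simp only [bump] at this
    rw [mem_Ioi]; linarith
  have hψ1 : ∫ r, ψ r = 1 := bump.integral_normed
  have hint : ∀ φ, RTest φ → Integrable (fun r => φ r * h r) (volume.restrict (Ioi 0)) := by
    intro φ hφ
    have h1 : IntegrableOn (fun r => φ r * h r) (tsupport φ) := by
      apply IntegrableOn.continuousOn_mul hφ.smooth.continuous.continuousOn _ hφ.supp
      exact hh.integrableOn_compact_subset hφ.sub hφ.supp
    have h2 : Integrable (fun r => φ r * h r) := by
      rwa [integrableOn_iff_integrable_of_support_subset] at h1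
      intro x hx
      apply subset_tsupport
      intro h0
      exact hx (by simp [h0])
    exact h2.integrableOn
  set c := ∫ r in Ioi 0, ψ r * h r with hc
  refine ⟨c, ?_⟩
  have hlc : LocallyIntegrableOn (fun _ : ℝ => c) (Ioi 0) :=
    (locallyIntegrable_const c).locallyIntegrableOn _
  have := isOpen_Ioi.ae_eq_zero_of_integral_contDiff_smul_eq_zero (U := Ioi (0:ℝ)) (μ := volume)
    (f := fun r => h r - c) (hh.sub hlc) ?_
  · filter_upwards [this] with r hr hr0
    linarith [hr hr0]
  intro φ hφ1 hφ2 hφ3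
  have hφ : RTest φ := ⟨hφ1, hφ2, hφ3⟩
  set J := ∫ r, φ r with hJ
  set θ : ℝ → ℝ := fun r => φ r - J * ψ r with hθ
  have hθs : ContDiff ℝ (⊤ : ℕ∞) θ := hφ1.sub (contDiff_const.mul hψ.smooth)
  have iφ : Integrable φ := hφ1.continuous.integrable_of_hasCompactSupport hφ2
  have iψ : Integrable ψ := hψ.smooth.continuous.integrable_of_hasCompactSupport hψ.supp
  have hθi : Integrable θ := iφ.sub (iψ.const_mul J)
  have hθ0 : ∫ r, θ r = 0 := by
    simp only [hθ]
    rw [integral_sub iφ (iψ.const_mul J), integral_const_mul, hψ1]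
    simp [hJ]
  obtain ⟨a, b, ha, ha1, hb1, hs⟩ := hφ.bounds
  obtain ⟨a', b', ha', ha1', hb1', hs'⟩ := hψ.bounds
  set A := min a a' with hA
  set B := max b b' with hB
  have hA0 : 0 < A := lt_min ha ha'
  have hA1 : A < 1 := (min_le_left _ _).trans_lt ha1
  have hB1 : 1 < B := hb1.trans_le (le_max_left _ _)
  have hAB : A < B := hA1.trans hB1
  have hzθ : ∀ r, r ∉ Ioo A B → θ r = 0 := by
    intro r hr
    have h1 : φ r = 0 := image_eq_zero_of_notMem_tsupport fun h =>
      hr ⟨(min_le_left _ _).trans_lt (hs h).1, (hs h).2.trans_le (le_max_left _ _)⟩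
    have h2 : ψ r = 0 := image_eq_zero_of_notMem_tsupport fun h =>
      hr ⟨(min_le_right _ _).trans_lt (hs' h).1, (hs' h).2.trans_le (le_max_right _ _)⟩
    simp [hθ, h1, h2]
  have hθAB : ∫ r in A..B, θ r = 0 := by
    rw [← hθ0, intervalIntegral.integral_of_le hAB.le, setIntegral_eq_integral_of_forall_compl_eq_zero]
    exact fun x hx => hzθ x fun h => hx ⟨h.1, h.2.le⟩
  set η : ℝ → ℝ := fun r => ∫ t in A..r, θ t with hη
  have hηd : ∀ r, HasDerivAt η (θ r) r := fun r =>
    intervalIntegral.integral_hasDerivAt_right (hθs.continuous.intervalIntegrable _ _)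
      hθs.continuous.aestronglyMeasurable.stronglyMeasurableAtFilter hθs.continuous.continuousAt
  have hηderiv : deriv η = θ := funext fun r => (hηd r).deriv
  have hη0 : ∀ r, r ∉ Icc A B → η r = 0 := by
    intro r hr
    simp only [mem_Icc, not_and_or, not_le] at hr
    rcases hr with hr | hr
    · simp only [hη]
      rw [intervalIntegral.integral_symm, intervalIntegral.integral_of_le hr.le,
        setIntegral_eq_zero_of_forall_eq_zero, neg_zero]
      exact fun x hx => hzθ x fun h => absurd h.1 (not_lt.2 hx.2)
    · simp only [hη]
      rw [← intervalIntegral.integral_add_adjacent_intervals (b := B)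
        (hθs.continuous.intervalIntegrable _ _) (hθs.continuous.intervalIntegrable _ _), hθAB,
        intervalIntegral.integral_of_le hr.le, setIntegral_eq_zero_of_forall_eq_zero, zero_add]
      exact fun x hx => hzθ x fun h => absurd h.2 (not_lt.2 hx.1.le)
  have hηsup : tsupport η ⊆ Icc A B := by
    apply closure_minimal _ isClosed_Icc
    intro x hx
    by_contra h
    exact hx (hη0 x h)
  have hηT : RTest η := by
    refine ⟨?_, HasCompactSupport.intro isCompact_Icc hη0, fun x hx => hA0.trans_le (hηsup hx).1⟩
    have : ContDiff ℝ ((⊤ : ℕ∞) : WithTop ℕ∞) η := by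
      rw [contDiff_infty_iff_deriv]
      refine ⟨fun r => (hηd r).differentiableAt, ?_⟩
      rw [hηderiv]; exact hθs
    exact this
  have key := hw η hηT
  rw [hηderiv] at key
  simp only [hθ, sub_mul, mul_assoc] at key
  rw [integral_sub (hint φ hφ) ((hint ψ hψ).const_mul J), integral_const_mul] at key
  have e1 : ∫ x, φ x • (h x - c) = ∫ x in Ioi 0, (φ x * h x - φ x * c) := by
    rw [setIntegral_eq_integral_of_forall_compl_eq_zero]
    · congr 1; ext x; simp only [smul_eq_mul]; ring
    · intro x hx
      have : φ x = 0 := image_eq_zero_of_notMem_tsupport fun h => hx (hφ3 h)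
      simp [this]
  have e2 : ∫ x in Ioi 0, φ x = J := by
    rw [setIntegral_eq_integral_of_forall_compl_eq_zero]
    intro x hx
    exact image_eq_zero_of_notMem_tsupport fun h => hx (hφ3 h)
  rw [e1, integral_sub (hint φ hφ) (iφ.mul_const c).integrableOn, integral_mul_const, e2]
  linarith

lemma RTest.integrable_mul {φ : ℝ → ℝ} (hφ : RTest φ) {h : ℝ → ℝ}
    (hh : LocallyIntegrableOn h (Ioi 0)) :
    Integrable (fun r => φ r * h r) (volume.restrict (Ioi 0)) := by
  have h1 : IntegrableOn (fun r => φ r * h r) (tsupport φ) := by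
    apply IntegrableOn.continuousOn_mul hφ.smooth.continuous.continuousOn _ hφ.supp
    exact hh.integrableOn_compact_subset hφ.sub hφ.supp
  have h2 : Integrable (fun r => φ r * h r) := by
    rwa [integrableOn_iff_integrable_of_support_subset] at h1
    intro x hx
    apply subset_tsupport
    intro h0
    exact hx (by simp [h0])
  exact h2.integrableOn

lemma RTest.deriv {φ : ℝ → ℝ} (hφ : RTest φ) : RTest (deriv φ) := by
  refine ⟨?_, hφ.supp.deriv, (closure_minimal support_deriv_subset (isClosed_tsupport φ)).trans hφ.sub⟩
  have : ContDiff ℝ ((⊤ : ℕ∞) : WithTop ℕ∞) φ := hφ.smooth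
  rw [contDiff_infty_iff_deriv] at this
  exact this.2

lemma weak_real {U F : ℝ → ℝ} (hU : LocallyIntegrableOn U (Ioi 0)) (hF : LocallyIntegrableOn F (Ioi 0))
    (hw : ∀ φ, RTest φ → ∫ r in Ioi 0, _root_.deriv φ r * U r = - ∫ r in Ioi 0, φ r * F r) :
    ∃ c, ∀ᵐ r, r ∈ Ioi (0:ℝ) → U r = c + ∫ t in (1:ℝ)..r, F t := by
  have hG : LocallyIntegrableOn (fun r => ∫ t in (1:ℝ)..r, F t) (Ioi 0) :=
    (prim_cont hF).locallyIntegrableOn measurableSet_Ioi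
  obtain ⟨c, hc⟩ := weak_const (hU.sub hG) (by
    intro φ hφ
    simp only [Pi.sub_apply, mul_sub]
    rw [integral_sub (hφ.deriv.integrable_mul hU) (hφ.deriv.integrable_mul hG), hw φ hφ, prim_parts hF hφ,
      sub_self])
  refine ⟨c, ?_⟩
  filter_upwards [hc] with r hr hr0
  have := hr hr0
  simp only [Pi.sub_apply] at this
  linarith

lemma loc_re {F : ℝ → ℂ} (hF : LocallyIntegrableOn F (Ioi 0)) :
    LocallyIntegrableOn (fun r => (F r).re) (Ioi 0) := by
  intro x hx
  obtain ⟨t, ht, hi⟩ := hF x hx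
  exact ⟨t, ht, hi.re⟩

lemma loc_im {F : ℝ → ℂ} (hF : LocallyIntegrableOn F (Ioi 0)) :
    LocallyIntegrableOn (fun r => (F r).im) (Ioi 0) := by
  intro x hx
  obtain ⟨t, ht, hi⟩ := hF x hx
  exact ⟨t, ht, hi.im⟩

lemma RTest.integrable_mulC {φ : ℝ → ℝ} (hφ : RTest φ) {h : ℝ → ℂ}
    (hh : LocallyIntegrableOn h (Ioi 0)) :
    Integrable (fun r => (φ r : ℂ) * h r) (volume.restrict (Ioi 0)) := by
  have h1 : IntegrableOn (fun r => (φ r : ℂ) * h r) (tsupport φ) := by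
    apply IntegrableOn.continuousOn_mul
      (Complex.continuous_ofReal.comp hφ.smooth.continuous).continuousOn _ hφ.supp
    exact hh.integrableOn_compact_subset hφ.sub hφ.supp
  have h2 : Integrable (fun r => (φ r : ℂ) * h r) := by
    rwa [integrableOn_iff_integrable_of_support_subset] at h1
    intro x hx
    apply subset_tsupport
    intro h0
    exact hx (by simp [h0])
  exact h2.integrableOn

lemma loc_iiC {F : ℝ → ℂ} (hF : LocallyIntegrableOn F (Ioi 0)) {a b : ℝ} (ha : 0 < a) (hb : 0 < b) :
    IntervalIntegrable F volume a b := by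
  rw [intervalIntegrable_iff']
  apply hF.integrableOn_compact_subset _ isCompact_uIcc
  intro x hx
  exact (lt_min ha hb).trans_le hx.1

lemma weak_complex {U F : ℝ → ℂ} (hU : LocallyIntegrableOn U (Ioi 0))
    (hF : LocallyIntegrableOn F (Ioi 0))
    (hw : ∀ φ, RTest φ → ∫ r in Ioi 0, ((deriv φ r : ℝ) : ℂ) * U r = - ∫ r in Ioi 0, (φ r : ℂ) * F r) :
    ∃ V : ℝ → ℂ, (∀ᵐ r, r ∈ Ioi (0:ℝ) → U r = V r) ∧ ContinuousOn V (Ioi 0) ∧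
      ∀ F' : ℝ → ℂ, ContinuousOn F' (Ioi 0) → (∀ᵐ r, r ∈ Ioi (0:ℝ) → F r = F' r) →
        ∀ r, 0 < r → HasDerivAt V (F' r) r := by
  obtain ⟨c, hc⟩ := weak_real (loc_re hU) (loc_re hF) (by
    intro φ hφ
    have h1 := congrArg Complex.re (hw φ hφ)
    rw [Complex.neg_re, ← Complex.reCLM_apply, ← Complex.reCLM_apply,
      ← ContinuousLinearMap.integral_comp_comm _ (hφ.deriv.integrable_mulC hU),
      ← ContinuousLinearMap.integral_comp_comm _ (hφ.integrable_mulC hF)] at h1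
    simpa using h1)
  obtain ⟨d, hd⟩ := weak_real (loc_im hU) (loc_im hF) (by
    intro φ hφ
    have h1 := congrArg Complex.im (hw φ hφ)
    rw [Complex.neg_im, ← Complex.imCLM_apply, ← Complex.imCLM_apply,
      ← ContinuousLinearMap.integral_comp_comm _ (hφ.deriv.integrable_mulC hU),
      ← ContinuousLinearMap.integral_comp_comm _ (hφ.integrable_mulC hF)] at h1
    simpa using h1)
  set V : ℝ → ℂ := fun r => ((c + ∫ t in (1:ℝ)..r, (F t).re : ℝ) : ℂ) +
    ((d + ∫ t in (1:ℝ)..r, (F t).im : ℝ) : ℂ) * I with hV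
  have hVc : ∀ r, 0 < r → V r = ((c : ℂ) + d * I) + ∫ t in (1:ℝ)..r, F t := by
    intro r hr
    have hi := loc_iiC hF one_pos hr
    have e1 := Complex.reCLM.intervalIntegral_comp_comm hi
    have e2 := Complex.imCLM.intervalIntegral_comp_comm hi
    simp only [Complex.reCLM_apply, Complex.imCLM_apply] at e1 e2
    simp only [hV]
    rw [e1, e2]
    push_cast
    linear_combination Complex.re_add_im (∫ t in (1:ℝ)..r, F t)
  refine ⟨V, ?_, ?_, ?_⟩
  · filter_upwards [hc, hd] with r h1 h2 hr
    apply Complex.ext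
    · simp [hV, h1 hr]
    · simp [hV, h2 hr]
  · have h1 := prim_cont (loc_re hF)
    have h2 := prim_cont (loc_im hF)
    have g1 : ContinuousOn (fun r => ((c + ∫ t in (1:ℝ)..r, (F t).re : ℝ) : ℂ)) (Ioi 0) :=
      Complex.continuous_ofReal.comp_continuousOn (continuousOn_const.add h1)
    have g2 : ContinuousOn (fun r => ((d + ∫ t in (1:ℝ)..r, (F t).im : ℝ) : ℂ)) (Ioi 0) :=
      Complex.continuous_ofReal.comp_continuousOn (continuousOn_const.add h2)
    exact g1.add (g2.mul continuousOn_const)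
  · intro F' hF' hFF r hr
    have hnh : Ioi (0:ℝ) ∈ nhds r := Ioi_mem_nhds hr
    have hsub : uIcc 1 r ⊆ Ioi (0:ℝ) := fun x hx => (lt_min one_pos hr).trans_le hx.1
    have h1 : HasDerivAt (fun r => ∫ t in (1:ℝ)..r, F' t) (F' r) r := by
      apply intervalIntegral.integral_hasDerivAt_right
      · exact (hF'.mono hsub).intervalIntegrable
      · exact hF'.stronglyMeasurableAtFilter isOpen_Ioi r hr
      · exact hF'.continuousAt hnh
    have h2 := h1.const_add ((c : ℂ) + d * I)
    refine h2.congr_of_eventuallyEq ?_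
    filter_upwards [hnh] with t ht
    rw [hVc t ht]
    congr 1
    apply intervalIntegral.integral_congr_ae
    filter_upwards [hFF] with x hx hx1
    exact hx ((lt_min one_pos ht).trans_le (uIoc_subset_uIcc hx1).1)

lemma mk2_zero' (a b : ℂ) : (mk2 a b) 0 = a := rfl
lemma mk2_one' (a b : ℂ) : (mk2 a b) 1 = b := rfl

lemma inner_CD2 (a b : CD2) : inner ℂ a b =
    (starRingEnd ℂ (a 0)) * b 0 + (starRingEnd ℂ (a 1)) * b 1 := by
  rw [PiLp.inner_apply, Fin.sum_univ_two]
  simp only [RCLike.inner_apply]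
  ring

/-- vector test functions from scalar ones -/
lemma RTest.vec {φ : ℝ → ℝ} (hφ : RTest φ) (w : CD2) : IsHalfLineTestFun (fun r => φ r • w) := by
  refine ⟨hφ.smooth.smul contDiff_const, hφ.supp.smul_right, ?_⟩
  exact (tsupport_smul_subset_left φ (fun _ => w)).trans hφ.sub

lemma IsHalfLineTestFun.memLp {g : ℝ → CD2} (hg : IsHalfLineTestFun g) :
    MemLp g 2 halfLineMeasure := by
  have : MemLp g 2 volume := hg.1.continuous.memLp_of_hasCompactSupport hg.2.1
  exact this.restrict _

lemma IsHalfLineTestFun.comp {g : ℝ → CD2} (hg : IsHalfLineTestFun g) (i : Fin 2) :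
    ContDiff ℝ (⊤ : ℕ∞) (fun r => g r i) ∧ HasCompactSupport (fun r => g r i) ∧ g 0 i = 0 := by
  refine ⟨?_, ?_, ?_⟩
  · have := hg.1
    exact (contDiff_piLp 2).1 this i
  · exact hg.2.1.comp_left (g := fun v : CD2 => v i) rfl
  · have : g 0 = 0 := image_eq_zero_of_notMem_tsupport fun h => lt_irrefl (0:ℝ) (hg.2.2 h)
    rw [this]; rfl

lemma dirac_symm (ν κ : ℝ) {g k : ℝ → CD2} (hg : IsHalfLineTestFun g) (hk : IsHalfLineTestFun k)
    (i1 : Integrable (fun r => inner ℂ (diracAct ν κ g r) (k r)) halfLineMeasure)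
    (i2 : Integrable (fun r => inner ℂ (g r) (diracAct ν κ k r)) halfLineMeasure) :
    ∫ r, inner ℂ (diracAct ν κ g r) (k r) ∂halfLineMeasure =
      ∫ r, inner ℂ (g r) (diracAct ν κ k r) ∂halfLineMeasure := by
  rw [← sub_eq_zero, ← integral_sub i1 i2]
  obtain ⟨g0, s0, z0⟩ := hg.comp 0
  obtain ⟨g1, s1, z1⟩ := hg.comp 1
  obtain ⟨k0, -, -⟩ := hk.comp 0
  obtain ⟨k1, -, -⟩ := hk.comp 1
  set P : ℝ → ℂ := fun r => starRingEnd ℂ (g r 0) * k r 1 - starRingEnd ℂ (g r 1) * k r 0 with hP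
  have c0 : ContDiff ℝ (⊤ : ℕ∞) (fun r => starRingEnd ℂ (g r 0)) :=
    Complex.conjCLE.contDiff.comp g0
  have c1 : ContDiff ℝ (⊤ : ℕ∞) (fun r => starRingEnd ℂ (g r 1)) :=
    Complex.conjCLE.contDiff.comp g1
  have hPc : ContDiff ℝ (⊤ : ℕ∞) P := (c0.mul k1).sub (c1.mul k0)
  have hPs : HasCompactSupport P := by
    have t0 : HasCompactSupport (fun r => starRingEnd ℂ (g r 0)) :=
      s0.comp_left (g := fun z : ℂ => starRingEnd ℂ z) (by simp)
    have t1 : HasCompactSupport (fun r => starRingEnd ℂ (g r 1)) :=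
      s1.comp_left (g := fun z : ℂ => starRingEnd ℂ z) (by simp)
    exact (t0.mul_right).sub (t1.mul_right)
  have hI := HasCompactSupport.integral_Ioi_deriv_eq (hPc.of_le (by simp)) hPs 0
  have hP0 : P 0 = 0 := by simp [hP, z0, z1]
  rw [hP0, neg_zero] at hI
  rw [← hI, halfLineMeasure]
  congr 1
  ext r
  have dd : ∀ {f : ℝ → ℂ}, ContDiff ℝ (⊤ : ℕ∞) f → HasDerivAt f (deriv f r) r := fun hf =>
    ((hf.differentiable (by simp)) r).hasDerivAt
  have d0 := Complex.conjCLE.hasFDerivAt.comp_hasDerivAt r (dd g0)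
  have d1 := Complex.conjCLE.hasFDerivAt.comp_hasDerivAt r (dd g1)
  have dP : deriv P r = _ := ((d0.mul (dd k1)).sub (d1.mul (dd k0))).deriv
  rw [dP]
  simp only [inner_CD2, diracAct, mk2_zero', mk2_one', Function.comp]
  simp only [map_sub, map_neg, map_mul, map_div₀, Complex.conj_ofReal,
    ContinuousLinearEquiv.coe_coe, Complex.conjCLE_apply]
  ring

lemma vec_act0 (ν κ : ℝ) {φ : ℝ → ℝ} (hφ : RTest φ) (r : ℝ) (v : CD2) :
    inner ℂ (diracAct ν κ (fun r => φ r • mk2 1 0) r) v =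
      (φ r : ℂ) * (-((ν : ℂ) / r) * v 0 - ((κ : ℂ) / r) * v 1) + ((deriv φ r : ℝ) : ℂ) * v 1 := by
  have hd : HasDerivAt (fun s => ((φ s : ℝ) : ℂ)) ((deriv φ r : ℝ) : ℂ) r :=
    ((hφ.smooth.differentiable (by simp)) r).hasDerivAt.ofReal_comp
  have e0 : (fun s => (φ s • mk2 1 0 : CD2) 0) = fun s => ((φ s : ℝ) : ℂ) := by
    ext s; simp [mk2_zero']
  have e1 : (fun s => (φ s • mk2 1 0 : CD2) 1) = fun s => 0 := by
    ext s; simp [mk2_one']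
  rw [inner_CD2]
  simp only [diracAct, mk2_zero', mk2_one']
  rw [e0, e1, hd.deriv]
  simp [mk2_zero', mk2_one']
  ring

lemma vec_act1 (ν κ : ℝ) {φ : ℝ → ℝ} (hφ : RTest φ) (r : ℝ) (v : CD2) :
    inner ℂ (diracAct ν κ (fun r => φ r • mk2 0 1) r) v =
      (φ r : ℂ) * (-((κ : ℂ) / r) * v 0 - ((ν : ℂ) / r) * v 1) - ((deriv φ r : ℝ) : ℂ) * v 0 := by
  have hd : HasDerivAt (fun s => ((φ s : ℝ) : ℂ)) ((deriv φ r : ℝ) : ℂ) r :=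
    ((hφ.smooth.differentiable (by simp)) r).hasDerivAt.ofReal_comp
  have e0 : (fun s => (φ s • mk2 0 1 : CD2) 1) = fun s => ((φ s : ℝ) : ℂ) := by
    ext s; simp [mk2_one']
  have e1 : (fun s => (φ s • mk2 0 1 : CD2) 0) = fun s => 0 := by
    ext s; simp [mk2_zero']
  rw [inner_CD2]
  simp only [diracAct, mk2_zero', mk2_one']
  rw [e0, e1, hd.deriv]
  simp [mk2_zero', mk2_one']
  ring

lemma vec_inner0 (c : ℝ) (v : CD2) : inner ℂ (c • mk2 1 0) v = (c : ℂ) * v 0 := by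
  rw [inner_CD2]; simp [mk2_zero', mk2_one']

lemma vec_inner1 (c : ℝ) (v : CD2) : inner ℂ (c • mk2 0 1) v = (c : ℂ) * v 1 := by
  rw [inner_CD2]; simp [mk2_zero', mk2_one']

lemma CD2_eq_zero {v : CD2} (h0 : v 0 = 0) (h1 : v 1 = 0) : v = 0 := by
  ext i
  fin_cases i
  · exact h0
  · exact h1

lemma lp_loc (u : Lp CD2 2 halfLineMeasure) (i : Fin 2) :
    LocallyIntegrableOn (fun r => (u : ℝ → CD2) r i) (Ioi 0) := by
  have h1 : MemLp (fun r => (u : ℝ → CD2) r i) 2 (volume.restrict (Ioi 0)) :=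
    (Lp.memLp u).eval_piLp i
  exact locallyIntegrableOn_of_locallyIntegrable_restrict (h1.locallyIntegrable (by norm_num))

lemma lp_sq (u : Lp CD2 2 halfLineMeasure) (i : Fin 2) :
    IntegrableOn (fun r => ‖(u : ℝ → CD2) r i‖ ^ 2) (Ioi 0) := by
  have h1 : MemLp (fun r => (u : ℝ → CD2) r i) 2 (volume.restrict (Ioi 0)) :=
    (Lp.memLp u).eval_piLp i
  exact (memLp_two_iff_integrable_sq_norm h1.1).1 h1

/-- An `L²` weak solution of `(d - σ i) u = 0` vanishes. -/
lemma weak_kernel {ν κ σ : ℝ} (h : 1 / 4 ≤ κ ^ 2 - ν ^ 2) (hσ : σ = 1 ∨ σ = -1)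
    (u : Lp CD2 2 halfLineMeasure)
    (hu : ∀ g, IsHalfLineTestFun g → ∫ r, inner ℂ (diracAct ν κ g r) (u r) ∂halfLineMeasure =
      (σ * I) * ∫ r, inner ℂ (g r) (u r) ∂halfLineMeasure) : u = 0 := by
  have l0 := lp_loc u 0
  have l1 := lp_loc u 1
  have hcd : ∀ c : ℝ, ContinuousOn (fun r : ℝ => (c : ℂ) / r) (Ioi 0) := by
    intro c
    apply ContinuousOn.div continuousOn_const Complex.continuous_ofReal.continuousOn
    intro r hr
    exact_mod_cast (ne_of_gt hr)
  have hloc : ∀ (c : ℝ → ℂ), ContinuousOn c (Ioi 0) → ∀ i : Fin 2,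
      LocallyIntegrableOn (fun r => c r * (u : ℝ → CD2) r i) (Ioi 0) := fun c hc i =>
    (lp_loc u i).continuousOn_mul hc isOpen_Ioi.isLocallyClosed
  set F0 : ℝ → ℂ := fun r => ((κ : ℂ) / r) * (u : ℝ → CD2) r 0 + ((ν : ℂ) / r) * (u : ℝ → CD2) r 1 +
    (σ * I) * (u : ℝ → CD2) r 1 with hF0
  set F1 : ℝ → ℂ := fun r => -(((κ : ℂ) / r) * (u : ℝ → CD2) r 1 + ((ν : ℂ) / r) * (u : ℝ → CD2) r 0 +
    (σ * I) * (u : ℝ → CD2) r 0) with hF1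
  have lF0 : LocallyIntegrableOn F0 (Ioi 0) :=
    ((hloc _ (hcd κ) 0).add (hloc _ (hcd ν) 1)).add (hloc _ continuousOn_const 1)
  have lF1 : LocallyIntegrableOn F1 (Ioi 0) :=
    (((hloc _ (hcd κ) 1).add (hloc _ (hcd ν) 0)).add (hloc _ continuousOn_const 0)).neg
  obtain ⟨V0, a0, b0, d0⟩ := weak_complex l0 lF0 (by
    intro φ hφ
    have h1 := hu _ (hφ.vec (mk2 0 1))
    simp only [vec_act1 ν κ hφ, vec_inner1] at h1
    replace h1 : ∫ r in Ioi 0, ((φ r : ℂ) * (-((κ : ℂ) / r) * (u : ℝ → CD2) r 0 -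
        ((ν : ℂ) / r) * (u : ℝ → CD2) r 1) - ((deriv φ r : ℝ) : ℂ) * (u : ℝ → CD2) r 0) =
        (σ * I) * ∫ r in Ioi 0, (φ r : ℂ) * (u : ℝ → CD2) r 1 := h1
    have i1 := hφ.deriv.integrable_mulC l0
    have i2 := hφ.integrable_mulC (((hloc _ (hcd κ) 0).neg).sub (hloc _ (hcd ν) 1))
    have i3 := hφ.integrable_mulC l1
    have e1 : ∫ r in Ioi 0, (φ r : ℂ) * F0 r = ∫ r in Ioi 0,
        ((σ * I) * ((φ r : ℂ) * (u : ℝ → CD2) r 1) -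
          (φ r : ℂ) * (-((κ : ℂ) / r) * (u : ℝ → CD2) r 0 - ((ν : ℂ) / r) * (u : ℝ → CD2) r 1)) := by
      congr 1; ext r; simp only [hF0]; ring
    have i2' : Integrable (fun r : ℝ => (φ r : ℂ) * (-((κ : ℂ) / r) * (u : ℝ → CD2) r 0 -
        ((ν : ℂ) / r) * (u : ℝ → CD2) r 1)) (volume.restrict (Ioi 0)) := by
      refine i2.congr (Filter.Eventually.of_forall fun r => ?_)
      simp
    rw [integral_sub i2' i1] at h1
    rw [e1, integral_sub (i3.const_mul _) i2', integral_const_mul]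
    linear_combination -h1)
  obtain ⟨V1, a1, b1, d1⟩ := weak_complex l1 lF1 (by
    intro φ hφ
    have h1 := hu _ (hφ.vec (mk2 1 0))
    simp only [vec_act0 ν κ hφ, vec_inner0] at h1
    replace h1 : ∫ r in Ioi 0, ((φ r : ℂ) * (-((ν : ℂ) / r) * (u : ℝ → CD2) r 0 -
        ((κ : ℂ) / r) * (u : ℝ → CD2) r 1) + ((deriv φ r : ℝ) : ℂ) * (u : ℝ → CD2) r 1) =
        (σ * I) * ∫ r in Ioi 0, (φ r : ℂ) * (u : ℝ → CD2) r 0 := h1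
    have i1 := hφ.deriv.integrable_mulC l1
    have i2 := hφ.integrable_mulC (((hloc _ (hcd ν) 0).neg).sub (hloc _ (hcd κ) 1))
    have i3 := hφ.integrable_mulC l0
    have e1 : ∫ r in Ioi 0, (φ r : ℂ) * F1 r = ∫ r in Ioi 0,
        ((φ r : ℂ) * (-((ν : ℂ) / r) * (u : ℝ → CD2) r 0 - ((κ : ℂ) / r) * (u : ℝ → CD2) r 1) -
          (σ * I) * ((φ r : ℂ) * (u : ℝ → CD2) r 0)) := by
      congr 1; ext r; simp only [hF1]; ring
    have i2' : Integrable (fun r : ℝ => (φ r : ℂ) * (-((ν : ℂ) / r) * (u : ℝ → CD2) r 0 -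
        ((κ : ℂ) / r) * (u : ℝ → CD2) r 1)) (volume.restrict (Ioi 0)) := by
      refine i2.congr (Filter.Eventually.of_forall fun r => ?_)
      simp
    rw [integral_add i2' i1] at h1
    rw [e1, integral_sub i2' (i3.const_mul _), integral_const_mul]
    linear_combination h1)
  have D0 := d0 (fun r => ((κ : ℂ) / r) * V0 r + ((ν : ℂ) / r) * V1 r + (σ * I) * V1 r)
    ((((hcd κ).mul b0).add ((hcd ν).mul b1)).add (continuousOn_const.mul b1)) (by
      filter_upwards [a0, a1] with r h0 h1 hr
      simp only [hF0]
      rw [h0 hr, h1 hr])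
  have D1 := d1 (fun r => -(((κ : ℂ) / r) * V1 r + ((ν : ℂ) / r) * V0 r + (σ * I) * V0 r))
    ((((hcd κ).mul b1).add ((hcd ν).mul b0)).add (continuousOn_const.mul b0)).neg (by
      filter_upwards [a0, a1] with r h0 h1 hr
      simp only [hF1]
      rw [h0 hr, h1 hr])
  have q0 : IntegrableOn (fun r => ‖V0 r‖ ^ 2) (Ioi 0) := by
    refine Integrable.congr (lp_sq u 0) ((ae_restrict_iff' measurableSet_Ioi).2 ?_)
    filter_upwards [a0] with r h0 hr
    rw [h0 hr]
  have q1 : IntegrableOn (fun r => ‖V1 r‖ ^ 2) (Ioi 0) := by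
    refine Integrable.congr (lp_sq u 1) ((ae_restrict_iff' measurableSet_Ioi).2 ?_)
    filter_upwards [a1] with r h1 hr
    rw [h1 hr]
  have hz := ode_zero h hσ D0 D1 q0 q1
  rw [Lp.eq_zero_iff_ae_eq_zero]
  refine (ae_restrict_iff' measurableSet_Ioi).2 ?_
  filter_upwards [a0, a1] with r h0 h1 hr
  exact CD2_eq_zero ((h0 hr).trans (hz r hr).1) ((h1 hr).trans (hz r hr).2)

lemma ortho_zero (u : Lp CD2 2 halfLineMeasure)
    (hu : ∀ g, IsHalfLineTestFun g → ∫ r, inner ℂ (g r) (u r) ∂halfLineMeasure = 0) : u = 0 := by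
  have key : ∀ i : Fin 2, (∀ φ, RTest φ → ∫ r in Ioi 0, (φ r : ℂ) * (u : ℝ → CD2) r i = 0) →
      ∀ᵐ r, r ∈ Ioi (0:ℝ) → (u : ℝ → CD2) r i = 0 := by
    intro i hi
    apply isOpen_Ioi.ae_eq_zero_of_integral_contDiff_smul_eq_zero (lp_loc u i)
    intro φ h1 h2 h3
    rw [← hi φ ⟨h1, h2, h3⟩, setIntegral_eq_integral_of_forall_compl_eq_zero]
    · simp
    · intro x hx
      have : φ x = 0 := image_eq_zero_of_notMem_tsupport fun h => hx (h3 h)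
      simp [this]
  have a0 := key 0 (by
    intro φ hφ
    have h1 := hu _ (hφ.vec (mk2 1 0))
    simpa only [vec_inner0, halfLineMeasure] using h1)
  have a1 := key 1 (by
    intro φ hφ
    have h1 := hu _ (hφ.vec (mk2 0 1))
    simpa only [vec_inner1, halfLineMeasure] using h1)
  rw [Lp.eq_zero_iff_ae_eq_zero]
  refine (ae_restrict_iff' measurableSet_Ioi).2 ?_
  filter_upwards [a0, a1] with r h0 h1 hr
  exact CD2_eq_zero (h0 hr) (h1 hr)

/-- For `κ² − ν² ≥ 1/4`, the Coulomb–Dirac operator `D^{ν,κ}`, i.e. any densely defined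
operator `T` in `L²((0,∞), ℂ²)` whose domain consists exactly of (classes of) smooth
compactly supported functions on `(0,∞)` and which acts there by the Coulomb–Dirac
differential expression, is essentially self-adjoint: its closure is self-adjoint. -/
theorem coulombDirac_essentially_selfAdjoint (ν κ : ℝ) (h : 1 / 4 ≤ κ ^ 2 - ν ^ 2)
    (T : Lp CD2 2 halfLineMeasure →ₗ.[ℂ] Lp CD2 2 halfLineMeasure)
    (hdom : ∀ f : Lp CD2 2 halfLineMeasure,
      f ∈ T.domain ↔ ∃ g : ℝ → CD2, IsHalfLineTestFun g ∧ (f : ℝ → CD2) =ᵐ[halfLineMeasure] g)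
    (hact : ∀ (f : T.domain) (g : ℝ → CD2), IsHalfLineTestFun g →
      ((f : Lp CD2 2 halfLineMeasure) : ℝ → CD2) =ᵐ[halfLineMeasure] g →
      ((T f : Lp CD2 2 halfLineMeasure) : ℝ → CD2) =ᵐ[halfLineMeasure] diracAct ν κ g) :
    IsSelfAdjoint T.closure := by
  have mk : ∀ g, IsHalfLineTestFun g → ∃ f : T.domain,
      ((f : Lp CD2 2 halfLineMeasure) : ℝ → CD2) =ᵐ[halfLineMeasure] g := by
    intro g hg
    have h1 := hg.memLp.coeFn_toLp
    exact ⟨⟨hg.memLp.toLp g, (hdom _).2 ⟨g, hg, h1⟩⟩, h1⟩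
  apply abs_sa
  · rw [Submodule.dense_iff_topologicalClosure_eq_top, Submodule.topologicalClosure_eq_top_iff,
      Submodule.eq_bot_iff]
    intro u hu
    apply ortho_zero
    intro g hg
    obtain ⟨f, hf⟩ := mk g hg
    have h1 := (Submodule.mem_orthogonal _ _).1 hu f f.2
    rw [L2.inner_def] at h1
    rw [← h1]
    apply integral_congr_ae
    filter_upwards [hf] with r hr
    rw [hr]
  · intro f k
    obtain ⟨g, hg, hfg⟩ := (hdom f).1 f.2
    obtain ⟨l, hl, hkl⟩ := (hdom k).1 k.2
    have t1 := hact f g hg hfg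
    have t2 := hact k l hl hkl
    have e1 : (fun r => inner ℂ ((T f : Lp CD2 2 halfLineMeasure) r)
        ((k : Lp CD2 2 halfLineMeasure) r)) =ᵐ[halfLineMeasure]
        fun r => inner ℂ (diracAct ν κ g r) (l r) := by
      filter_upwards [t1, hkl] with r h1 h2
      rw [h1, h2]
    have e2 : (fun r => inner ℂ ((f : Lp CD2 2 halfLineMeasure) r)
        ((T k : Lp CD2 2 halfLineMeasure) r)) =ᵐ[halfLineMeasure]
        fun r => inner ℂ (g r) (diracAct ν κ l r) := by
      filter_upwards [t2, hfg] with r h1 h2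
      rw [h1, h2]
    rw [L2.inner_def, L2.inner_def, integral_congr_ae e1, integral_congr_ae e2]
    exact dirac_symm ν κ hg hl ((L2.integrable_inner _ _).congr e1)
      ((L2.integrable_inner _ _).congr e2)
  · intro σ hσ u hu
    apply weak_kernel h hσ u
    intro g hg
    obtain ⟨f, hf⟩ := mk g hg
    have h1 := hu f
    have t1 := hact f g hg hf
    rw [L2.inner_def, L2.inner_def] at h1
    have e1 : (fun r => inner ℂ ((T f : Lp CD2 2 halfLineMeasure) r) (u r)) =ᵐ[halfLineMeasure]
        fun r => inner ℂ (diracAct ν κ g r) (u r) := by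
      filter_upwards [t1] with r h1
      rw [h1]
    have e2 : (fun r => inner ℂ ((f : Lp CD2 2 halfLineMeasure) r) (u r)) =ᵐ[halfLineMeasure]
        fun r => inner ℂ (g r) (u r) := by
      filter_upwards [hf] with r h1
      rw [h1]
    rw [integral_congr_ae e1, integral_congr_ae e2] at h1
    exact h1

end
end

section
/- Let ν, κ ∈ ℝ with κ² − ν² < 1/4. Consider the densely defined symmetric operator D^{ν,κ} in the Hilbert space L²((0,∞), ℂ²) whose domain is the space of smooth compactly supported functions C_c^∞((0,∞), ℂ²) and which acts by (D^{ν,κ}f)(r) = ( −(ν/r)f₁(r) − f₂′(r) − (κ/r)f₂(r) , f₁′(r) − (κ/r)f₁(r) − (ν/r)f₂(r) ). Then D^{ν,κ} is not essentially self-adjoint: its closure is not a self-adjoint operator in L²((0,∞), ℂ²). -/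
open MeasureTheory Set Complex

noncomputable section

lemma cd_abstract {E : Type*} [NormedAddCommGroup E] [InnerProductSpace ℂ E] [CompleteSpace E]
    (T : E →ₗ.[ℂ] E) (hT : IsSelfAdjoint T.closure) (u u' v v' : E)
    (hu : ∀ x : T.domain, inner ℂ (T x) u = inner ℂ (x : E) u')
    (hv : ∀ x : T.domain, inner ℂ (T x) v = inner ℂ (x : E) v') :
    inner ℂ v' u = inner ℂ v u' := by
  have hd := hT.dense_domain
  have hg := LinearPMap.adjoint_graph_eq_graph_adjoint hd
  rw [LinearPMap.isSelfAdjoint_def.1 hT] at hg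
  have hle : (T.closure.graph : Set (E × E)) ⊆ closure (T.graph : Set (E × E)) := by
    by_cases hc : T.IsClosable
    · rw [← hc.graph_closure_eq_closure_graph]
      exact subset_rfl
    · rw [LinearPMap.closure_def' hc]
      exact subset_closure
  have key : ∀ w w' : E, (∀ x : T.domain, inner ℂ (T x) w = inner ℂ (x : E) w') →
      (w, w') ∈ T.closure.graph := by
    intro w w' hw
    rw [hg, Submodule.mem_adjoint_iff]
    intro a b hab
    have hcl : IsClosed {z : E × E | inner ℂ z.2 w - inner ℂ z.1 w' = 0} :=
      isClosed_eq (by fun_prop) continuous_const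
    refine closure_minimal (t := {z : E × E | inner ℂ z.2 w - inner ℂ z.1 w' = 0}) ?_ hcl (hle hab)
    rintro ⟨c, d⟩ hcd
    obtain ⟨y, hy1, hy2⟩ := (LinearPMap.mem_graph_iff _).1 hcd
    simp only at hy1 hy2
    subst hy1
    subst hy2
    simp [hw y]
  have h1 := key u u' hu
  have h2 := key v v' hv
  rw [hg, Submodule.mem_adjoint_iff] at h1
  exact sub_eq_zero.1 (h1 v v' h2)

lemma cd_memLp_rpow (a : ℝ) (ha : -(1/2) < a) :
    MemLp (fun r : ℝ => Real.exp (-r) * r ^ a) 2 halfLineMeasure := by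
  rw [halfLineMeasure]
  have hc : ContinuousOn (fun r : ℝ => Real.exp (-r) * r ^ a) (Ioi 0) := by
    apply ContinuousOn.mul (by fun_prop)
    intro x hx
    exact (Real.continuousAt_rpow_const x a (Or.inl (ne_of_gt hx))).continuousWithinAt
  rw [memLp_two_iff_integrable_sq (hc.aestronglyMeasurable measurableSet_Ioi)]
  have := integrableOn_rpow_mul_exp_neg_mul_rpow (p := 1) (s := 2 * a) (b := 2) (by linarith)
    one_pos two_pos
  refine this.congr_fun ?_ measurableSet_Ioi
  intro x hx
  have hx' : (0:ℝ) < x := hx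
  simp only [Real.rpow_one]
  rw [mul_pow, ← Real.exp_nat_mul, mul_comm 2 a, Real.rpow_mul hx'.le, Real.rpow_two]
  push_cast
  ring_nf

lemma cd_memLp_of_bound (b K : ℝ) (hb0 : 0 ≤ b) (hb : b < 1/2) (C : ℝ → ℝ)
    (hC : ContinuousOn C (Ioi 0)) (hK : ∀ r, 0 < r → |C r| ≤ K * (r ^ b + r ^ (-b))) :
    MemLp (fun r : ℝ => Real.exp (-r) * C r) 2 halfLineMeasure := by
  have h1 := ((cd_memLp_rpow b (by linarith)).add (cd_memLp_rpow (-b) (by linarith))).const_mul K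
  refine h1.mono ?_ ?_
  · have : ContinuousOn (fun r : ℝ => Real.exp (-r) * C r) (Ioi 0) :=
      ContinuousOn.mul (by fun_prop) hC
    exact this.aestronglyMeasurable measurableSet_Ioi
  · refine ae_restrict_of_forall_mem measurableSet_Ioi ?_
    intro r hr
    have hr' : (0:ℝ) < r := hr
    simp only [Pi.add_apply, Real.norm_eq_abs, abs_mul, Real.abs_exp]
    rw [← mul_add, abs_mul, Real.abs_exp]
    have h2 := hK r hr
    have h3 : |K| * |r ^ b + r ^ (-b)| = |K * (r ^ b + r ^ (-b))| := (abs_mul _ _).symm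
    calc Real.exp (-r) * |C r| ≤ Real.exp (-r) * |K * (r ^ b + r ^ (-b))| := by
          exact mul_le_mul_of_nonneg_left (h2.trans (le_abs_self _)) (Real.exp_pos _).le
      _ = _ := by rw [← h3]; ring

lemma cd_exists (δ : ℝ) (hδ : δ < 1/4) : ∃ C S : ℝ → ℝ,
    (∀ r, 0 < r → HasDerivAt C (δ * S r / r) r) ∧
    (∀ r, 0 < r → HasDerivAt S (C r / r) r) ∧
    (∀ r, 0 < r → C r ^ 2 - δ * S r ^ 2 = 1) ∧
    MemLp (fun r : ℝ => Real.exp (-r) * C r) 2 halfLineMeasure ∧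
    MemLp (fun r : ℝ => Real.exp (-r) * S r) 2 halfLineMeasure := by
  suffices H : ∃ C S : ℝ → ℝ, ∃ b K : ℝ, 0 ≤ b ∧ b < 1/2 ∧
    (∀ r, 0 < r → HasDerivAt C (δ * S r / r) r) ∧
    (∀ r, 0 < r → HasDerivAt S (C r / r) r) ∧
    (∀ r, 0 < r → C r ^ 2 - δ * S r ^ 2 = 1) ∧
    (∀ r, 0 < r → |C r| ≤ K * (r ^ b + r ^ (-b))) ∧
    (∀ r, 0 < r → |S r| ≤ K * (r ^ b + r ^ (-b))) by
    obtain ⟨C, S, b, K, hb0, hb, hC, hS, hW, hCK, hSK⟩ := H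
    refine ⟨C, S, hC, hS, hW, cd_memLp_of_bound b K hb0 hb C ?_ hCK,
      cd_memLp_of_bound b K hb0 hb S ?_ hSK⟩
    · exact fun x hx => (hC x hx).continuousAt.continuousWithinAt
    · exact fun x hx => (hS x hx).continuousAt.continuousWithinAt
  rcases lt_trichotomy δ 0 with hneg | rfl | hpos
  · obtain ⟨w, hw, hwδ⟩ : ∃ w : ℝ, 0 < w ∧ δ = -w ^ 2 :=
      ⟨Real.sqrt (-δ), Real.sqrt_pos.2 (by linarith), by rw [Real.sq_sqrt (by linarith)]; ring⟩
    subst hwδ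
    refine ⟨fun r => Real.cos (w * Real.log r), fun r => Real.sin (w * Real.log r) / w, 0,
      max 1 (1 / w), le_rfl, by norm_num, ?_, ?_, ?_, ?_, ?_⟩
    · intro r hr
      refine HasDerivAt.congr_deriv (((Real.hasDerivAt_log hr.ne').const_mul w).cos) ?_
      field_simp
    · intro r hr
      refine HasDerivAt.congr_deriv ((((Real.hasDerivAt_log hr.ne').const_mul w).sin).div_const w) ?_
      field_simp
    · intro r hr
      have := Real.sin_sq_add_cos_sq (w * Real.log r)
      field_simp
      linarith
    · intro r hr
      have := Real.abs_cos_le_one (w * Real.log r)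
      have h2 := le_max_left 1 (1 / w)
      simp only [neg_zero, Real.rpow_zero]
      linarith
    · intro r hr
      have := Real.abs_sin_le_one (w * Real.log r)
      have h2 := le_max_right 1 (1 / w)
      have h3 : 0 < 1 / w := by positivity
      simp only [neg_zero, Real.rpow_zero]
      rw [abs_div, abs_of_pos hw]
      have : |Real.sin (w * Real.log r)| / w ≤ 1 / w := by gcongr
      linarith
  · refine ⟨fun r => 1, fun r => Real.log r, 1/4, 4, by norm_num, by norm_num, ?_, ?_, ?_, ?_, ?_⟩
    · intro r hr
      simpa using hasDerivAt_const r (1:ℝ)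
    · intro r hr
      simpa using Real.hasDerivAt_log hr.ne'
    · intro r hr
      simp
    · intro r hr
      rcases le_total 1 r with h1 | h1
      · have := Real.one_le_rpow h1 (show (0:ℝ) ≤ 1/4 by norm_num)
        have h2 := Real.rpow_pos_of_pos hr (-(1/4))
        rw [abs_one]
        linarith
      · have := Real.one_le_rpow_of_pos_of_le_one_of_nonpos hr h1 (show -(1/4 : ℝ) ≤ 0 by norm_num)
        have h2 := Real.rpow_pos_of_pos hr (1/4)
        rw [abs_one]
        linarith
    · intro r hr
      have h1 := Real.log_le_rpow_div hr.le (show (0:ℝ) < 1/4 by norm_num)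
      have h2 := Real.log_le_rpow_div (inv_pos.2 hr).le (show (0:ℝ) < 1/4 by norm_num)
      rw [Real.log_inv, Real.inv_rpow hr.le, ← Real.rpow_neg hr.le] at h2
      have h3 := Real.rpow_pos_of_pos hr (1/4)
      have h4 := Real.rpow_pos_of_pos hr (-(1/4))
      rw [abs_le]
      constructor <;> linarith
  · obtain ⟨w, hw, hwδ⟩ : ∃ w : ℝ, 0 < w ∧ δ = w ^ 2 :=
      ⟨Real.sqrt (δ), Real.sqrt_pos.2 (by linarith), by rw [Real.sq_sqrt (by linarith)]⟩
    subst hwδ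
    have hrp : ∀ r : ℝ, 0 < r → r ^ w = Real.exp (w * Real.log r) ∧
        r ^ (-w) = Real.exp (-(w * Real.log r)) := by
      intro r hr
      rw [Real.rpow_def_of_pos hr, Real.rpow_def_of_pos hr]
      constructor <;> ring_nf
    refine ⟨fun r => Real.cosh (w * Real.log r), fun r => Real.sinh (w * Real.log r) / w, w,
      max 1 (1 / w), hw.le, by nlinarith, ?_, ?_, ?_, ?_, ?_⟩
    · intro r hr
      refine HasDerivAt.congr_deriv (((Real.hasDerivAt_log hr.ne').const_mul w).cosh) ?_
      field_simp
    · intro r hr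
      refine HasDerivAt.congr_deriv ((((Real.hasDerivAt_log hr.ne').const_mul w).sinh).div_const w) ?_
      field_simp
    · intro r hr
      have := Real.cosh_sq_sub_sinh_sq (w * Real.log r)
      field_simp
      linarith
    · intro r hr
      have h2 := le_max_left 1 (1 / w)
      obtain ⟨e1, e2⟩ := hrp r hr
      have p1 := Real.exp_pos (w * Real.log r)
      have p2 := Real.exp_pos (-(w * Real.log r))
      simp only
      rw [e1, e2, abs_of_pos (Real.cosh_pos _), Real.cosh_eq]
      nlinarith
    · intro r hr
      have h2 := le_max_right 1 (1 / w)
      obtain ⟨e1, e2⟩ := hrp r hr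
      have p1 := Real.exp_pos (w * Real.log r)
      have p2 := Real.exp_pos (-(w * Real.log r))
      simp only
      have h3 : |Real.sinh (w * Real.log r)| ≤
          Real.exp (w * Real.log r) + Real.exp (-(w * Real.log r)) := by
        rw [Real.sinh_eq, abs_le]
        constructor <;> linarith
      rw [e1, e2, abs_div, abs_of_pos hw, div_eq_mul_one_div, mul_comm]
      gcongr

lemma cd_memLp_mk2 {p q : ℝ → ℝ} (hp : MemLp p 2 halfLineMeasure)
    (hq : MemLp q 2 halfLineMeasure) :
    MemLp (fun r => mk2 (p r) (q r)) 2 halfLineMeasure := by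
  have h1 : ∀ (c : CD2) {f : ℝ → ℝ}, MemLp f 2 halfLineMeasure →
      MemLp (fun r => f r • c) 2 halfLineMeasure := by
    intro c f hf
    exact (ContinuousLinearMap.toSpanSingleton ℝ c).comp_memLp' hf
  convert (h1 (mk2 1 0) hp).add (h1 (mk2 0 1) hq) using 1
  ext r i
  fin_cases i <;> simp [mk2]

lemma cd_inner_mk2 (p q : ℝ) (x : CD2) :
    inner ℂ (mk2 p q) x = (p : ℂ) * x 0 + (q : ℂ) * x 1 := by
  simp [mk2, PiLp.inner_apply, Fin.sum_univ_two]
  ring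

lemma cd_adj (ν κ : ℝ) (T : Lp CD2 2 halfLineMeasure →ₗ.[ℂ] Lp CD2 2 halfLineMeasure)
    (hdom : ∀ f : Lp CD2 2 halfLineMeasure,
      f ∈ T.domain ↔ ∃ g : ℝ → CD2, IsHalfLineTestFun g ∧ (f : ℝ → CD2) =ᵐ[halfLineMeasure] g)
    (hact : ∀ (f : T.domain) (g : ℝ → CD2), IsHalfLineTestFun g →
      ((f : Lp CD2 2 halfLineMeasure) : ℝ → CD2) =ᵐ[halfLineMeasure] g →
      ((T f : Lp CD2 2 halfLineMeasure) : ℝ → CD2) =ᵐ[halfLineMeasure] diracAct ν κ g)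
    (p q : ℝ → ℝ)
    (hp : ∀ r, 0 < r → HasDerivAt p (κ / r * p r + ν / r * q r - p r) r)
    (hq : ∀ r, 0 < r → HasDerivAt q (-(ν / r) * p r - κ / r * q r - q r) r)
    (U U' : Lp CD2 2 halfLineMeasure)
    (hU : (U : ℝ → CD2) =ᵐ[halfLineMeasure] fun r => mk2 (p r) (q r))
    (hU' : (U' : ℝ → CD2) =ᵐ[halfLineMeasure] fun r => mk2 (q r) ((-p r : ℝ) : ℂ))
    (x : T.domain) :
    inner ℂ (T x) U = inner ℂ (x : Lp CD2 2 halfLineMeasure) U' := by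
  rw [← inner_conj_symm, ← inner_conj_symm (x : Lp CD2 2 halfLineMeasure)]
  congr 1
  obtain ⟨g, hg, hxg⟩ := (hdom x).1 x.2
  have hTx := hact x g hg hxg
  obtain ⟨hsm, hcs, hsup⟩ := hg
  rw [← sub_eq_zero, L2.inner_def, L2.inner_def,
    ← integral_sub (L2.integrable_inner _ _) (L2.integrable_inner _ _)]
  have hdiff : ∀ i r, HasDerivAt (fun s => g s i) (deriv (fun s => g s i) r) r := by
    intro i r
    have h1 : DifferentiableAt ℝ g r := hsm.differentiable (by simp) r
    have h2 : DifferentiableAt ℝ (fun s => g s i) r := by fun_prop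
    exact h2.hasDerivAt
  set F : ℝ → ℂ := fun r => (q r : ℂ) * g r 0 - (p r : ℂ) * g r 1 with hF
  set F' : ℝ → ℂ := fun r =>
    (((-(ν / r) * p r - κ / r * q r - q r : ℝ) : ℂ) * g r 0 + (q r : ℂ) * deriv (fun s => g s 0) r)
     - (((κ / r * p r + ν / r * q r - p r : ℝ) : ℂ) * g r 1 + (p r : ℂ) * deriv (fun s => g s 1) r)
    with hF'
  have hderiv : ∀ r ∈ Ioi (0:ℝ), HasDerivAt F (F' r) r := by
    intro r hr
    exact ((hq r hr).ofReal_comp.mul (hdiff 0 r)).sub ((hp r hr).ofReal_comp.mul (hdiff 1 r))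
  have hae : (fun r => inner ℂ ((U : ℝ → CD2) r) ((T x : Lp CD2 2 halfLineMeasure) r)
      - inner ℂ ((U' : ℝ → CD2) r) ((x : Lp CD2 2 halfLineMeasure) r)) =ᵐ[halfLineMeasure] F' := by
    filter_upwards [hU, hU', hxg, hTx] with r h1 h2 h3 h4
    rw [h1, h2, h3, h4, cd_inner_mk2, cd_inner_mk2]
    simp only [hF', diracAct, mk2, WithLp.equiv_symm_apply, PiLp.toLp_apply, Matrix.cons_val_zero,
      Matrix.cons_val_one]
    push_cast
    ring
  have hint : IntegrableOn F' (Ioi 0) :=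
    ((L2.integrable_inner (𝕜 := ℂ) U (T x)).sub (L2.integrable_inner (𝕜 := ℂ) U' x)).congr hae
  rw [integral_congr_ae hae, halfLineMeasure]
  have h0 : (0:ℝ) ∉ tsupport g := fun h => lt_irrefl (0:ℝ) (hsup h)
  have hz : g =ᶠ[nhds 0] 0 := notMem_tsupport_iff_eventuallyEq.1 h0
  have hFz : F =ᶠ[nhds 0] fun _ => 0 := by
    filter_upwards [hz] with r hr
    simp [hF, hr]
  have hinf : g =ᶠ[Filter.atTop] 0 := by
    have := hcs.isCompact.compl_mem_cocompact
    have h2 := _root_.atTop_le_cocompact (α := ℝ) this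
    filter_upwards [h2] with r hr
    exact image_eq_zero_of_notMem_tsupport hr
  have hFi : F =ᶠ[Filter.atTop] fun _ => 0 := by
    filter_upwards [hinf] with r hr
    simp [hF, hr]
  have := integral_Ioi_of_hasDerivAt_of_tendsto (a := 0) (m := 0) (f := F) (f' := F')
    (ContinuousAt.continuousWithinAt (continuousAt_const.congr hFz.symm)) hderiv hint
    (tendsto_const_nhds.congr' hFi.symm)
  rw [this, hFz.eq_of_nhds, sub_zero]

/-- For `κ² − ν² < 1/4`, the Coulomb–Dirac operator `D^{ν,κ}`, i.e. any densely defined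
operator `T` in `L²((0,∞), ℂ²)` whose domain consists exactly of (classes of) smooth
compactly supported functions on `(0,∞)` and which acts there by the Coulomb–Dirac
differential expression, is not essentially self-adjoint: its closure is not a self-adjoint operator. -/
theorem coulombDirac_not_essentially_selfAdjoint (ν κ : ℝ) (h : κ ^ 2 - ν ^ 2 < 1 / 4)
    (T : Lp CD2 2 halfLineMeasure →ₗ.[ℂ] Lp CD2 2 halfLineMeasure)
    (hdom : ∀ f : Lp CD2 2 halfLineMeasure,
      f ∈ T.domain ↔ ∃ g : ℝ → CD2, IsHalfLineTestFun g ∧ (f : ℝ → CD2) =ᵐ[halfLineMeasure] g)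
    (hact : ∀ (f : T.domain) (g : ℝ → CD2), IsHalfLineTestFun g →
      ((f : Lp CD2 2 halfLineMeasure) : ℝ → CD2) =ᵐ[halfLineMeasure] g →
      ((T f : Lp CD2 2 halfLineMeasure) : ℝ → CD2) =ᵐ[halfLineMeasure] diracAct ν κ g) :
    ¬ IsSelfAdjoint T.closure := by
  intro hsa
  obtain ⟨C, S, hC, hS, hW, hCL, hSL⟩ := cd_exists (κ ^ 2 - ν ^ 2) h
  have hE : ∀ r : ℝ, HasDerivAt (fun r => Real.exp (-r)) (-Real.exp (-r)) r := by
    intro r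
    simpa using (hasDerivAt_neg r).exp
  set p : ℝ → ℝ := fun r => Real.exp (-r) * (C r + κ * S r) with hp
  set q : ℝ → ℝ := fun r => Real.exp (-r) * (-ν * S r) with hq
  set p2 : ℝ → ℝ := fun r => Real.exp (-r) * (ν * S r) with hp2
  set q2 : ℝ → ℝ := fun r => Real.exp (-r) * (C r - κ * S r) with hq2
  have Lp1 : MemLp p 2 halfLineMeasure := by
    convert hCL.add (hSL.const_mul κ) using 1
    ext r; simp only [hp, Pi.add_apply]; ring
  have Lq1 : MemLp q 2 halfLineMeasure := by
    convert hSL.const_mul (-ν) using 1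
    ext r; simp only [hq]; ring
  have Lp2 : MemLp p2 2 halfLineMeasure := by
    convert hSL.const_mul ν using 1
    ext r; simp only [hp2]; ring
  have Lq2 : MemLp q2 2 halfLineMeasure := by
    convert hCL.sub (hSL.const_mul κ) using 1
    ext r; simp only [hq2, Pi.sub_apply]; ring
  have m1 := cd_memLp_mk2 Lp1 Lq1
  have m1' := cd_memLp_mk2 (q := fun r => -p r) Lq1 Lp1.neg
  have m2 := cd_memLp_mk2 Lp2 Lq2
  have m2' := cd_memLp_mk2 (q := fun r => -p2 r) Lq2 Lp2.neg
  have a1 := cd_adj ν κ T hdom hact p q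
    (by
      intro r hr
      refine HasDerivAt.congr_deriv ((hE r).mul ((hC r hr).add ((hS r hr).const_mul κ))) ?_
      simp only [hp, hq, Pi.add_apply]; field_simp; ring)
    (by
      intro r hr
      refine HasDerivAt.congr_deriv ((hE r).mul ((hS r hr).const_mul (-ν))) ?_
      simp only [hp, hq]; field_simp; ring)
    (m1.toLp _) (m1'.toLp _) m1.coeFn_toLp m1'.coeFn_toLp
  have a2 := cd_adj ν κ T hdom hact p2 q2
    (by
      intro r hr
      refine HasDerivAt.congr_deriv ((hE r).mul ((hS r hr).const_mul ν)) ?_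
      simp only [hp2, hq2]; field_simp; ring)
    (by
      intro r hr
      refine HasDerivAt.congr_deriv ((hE r).mul ((hC r hr).sub ((hS r hr).const_mul κ))) ?_
      simp only [hp2, hq2, Pi.sub_apply]; field_simp; ring)
    (m2.toLp _) (m2'.toLp _) m2.coeFn_toLp m2'.coeFn_toLp
  have key := cd_abstract T hsa _ _ _ _ a1 a2
  rw [L2.inner_def, L2.inner_def] at key
  have e1 : ∫ r, inner ℂ ((m2'.toLp _ : Lp CD2 2 halfLineMeasure) r)
      ((m1.toLp _ : Lp CD2 2 halfLineMeasure) r) ∂halfLineMeasure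
      = ∫ r, ((Real.exp (-2 * r) : ℝ) : ℂ) ∂halfLineMeasure := by
    apply integral_congr_ae
    have hpos : ∀ᵐ r ∂halfLineMeasure, (0:ℝ) < r := ae_restrict_mem measurableSet_Ioi
    filter_upwards [m2'.coeFn_toLp, m1.coeFn_toLp, hpos] with r h1 h2 h3
    rw [h1, h2, cd_inner_mk2]
    simp only [mk2, WithLp.equiv_symm_apply, PiLp.toLp_apply, Matrix.cons_val_zero,
      Matrix.cons_val_one]
    have hx : Real.exp (-2 * r) = Real.exp (-r) * Real.exp (-r) := by
      rw [← Real.exp_add]; ring_nf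
    rw [hx]
    norm_cast
    simp only [hp, hq, hp2, hq2]
    linear_combination (Real.exp (-r) * Real.exp (-r)) * hW r h3
  have e2 : ∫ r, inner ℂ ((m2.toLp _ : Lp CD2 2 halfLineMeasure) r)
      ((m1'.toLp _ : Lp CD2 2 halfLineMeasure) r) ∂halfLineMeasure
      = ∫ r, -((Real.exp (-2 * r) : ℝ) : ℂ) ∂halfLineMeasure := by
    apply integral_congr_ae
    have hpos : ∀ᵐ r ∂halfLineMeasure, (0:ℝ) < r := ae_restrict_mem measurableSet_Ioi
    filter_upwards [m2.coeFn_toLp, m1'.coeFn_toLp, hpos] with r h1 h2 h3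
    rw [h1, h2, cd_inner_mk2]
    simp only [mk2, WithLp.equiv_symm_apply, PiLp.toLp_apply, Matrix.cons_val_zero,
      Matrix.cons_val_one]
    have hx : Real.exp (-2 * r) = Real.exp (-r) * Real.exp (-r) := by
      rw [← Real.exp_add]; ring_nf
    rw [hx]
    norm_cast
    simp only [hp, hq, hp2, hq2]
    linear_combination -(Real.exp (-r) * Real.exp (-r)) * hW r h3
  rw [e1, e2, integral_neg, integral_complex_ofReal, halfLineMeasure,
    integral_exp_mul_Ioi (by norm_num)] at key
  norm_num at key

end
end
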